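/- arXiv:1108.0064 — 3 statements merged into one kernel-verified Lean document; each statement's English description precedes it below -/
import Mathlib

section
/- Let G be a finite simple graph and let n ≥ 1. Then G covers the complete graph K_n if and only if the vertex set of G can be partitioned into n 1-perfect codes; equivalently, if and only if there exists a function c : V(G) → Fin n such that for every vertex v of G and every color i, the closed neighborhood N_G[v] contains exactly one vertex of color i. -/
open SimpleGraph

/-- A graph homomorphism `f : G →g H` is *locally bijective* if for every vertex `v`,
`f` maps the closed neighborhood of `v` in `G` bijectively onto the closed
neighborhood of `f v` in `H`. -/
def LocallyBijective {V W : Type*} (G : SimpleGraph V) (H : SimpleGraph W)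
    (f : G →g H) : Prop :=
  ∀ v : V, Set.BijOn f (insert v (G.neighborSet v)) (insert (f v) (H.neighborSet (f v)))

/-- The closed neighborhood of any vertex of a complete graph is everything. -/
theorem insert_neighborSet_completeGraph {W : Type*} (w : W) :
    insert w ((completeGraph W).neighborSet w) = Set.univ := by
  ext x
  simp [eq_comm, em]

/-- A finite graph `G` covers the complete graph `K_n` (`n ≥ 1`) iff there is a coloring
`c : V → Fin n` such that every closed neighborhood contains exactly one vertex of each
color, i.e. iff the vertices can be partitioned into `n` 1-perfect codes. -/
theorem covers_completeGraph_iff_perfect_codes {V : Type*} [Fintype V]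
    (G : SimpleGraph V) (n : ℕ) (hn : 1 ≤ n) :
    (∃ f : G →g completeGraph (Fin n), LocallyBijective G (completeGraph (Fin n)) f) ↔
      ∃ c : V → Fin n, ∀ v : V, ∀ i : Fin n,
        ∃! u : V, u ∈ insert v (G.neighborSet v) ∧ c u = i := by
  constructor
  · rintro ⟨f, hf⟩
    refine ⟨f, fun v i => ?_⟩
    have h := hf v
    rw [insert_neighborSet_completeGraph] at h
    obtain ⟨u, hu, hui⟩ := h.surjOn (Set.mem_univ i)
    exact ⟨u, ⟨hu, hui⟩, fun w hw => h.injOn hw.1 hu (hw.2.trans hui.symm)⟩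
  · rintro ⟨c, hc⟩
    refine ⟨⟨c, fun {a b} hab hcab => ?_⟩, fun v => ?_⟩
    · exact hab.ne ((hc a (c a)).unique ⟨Set.mem_insert _ _, rfl⟩
        ⟨Set.mem_insert_of_mem _ hab, hcab.symm⟩)
    · rw [insert_neighborSet_completeGraph]
      refine ⟨fun _ _ => Set.mem_univ _, fun a ha b hb hab => ?_, fun i _ => ?_⟩
      · exact (hc v (c b)).unique ⟨ha, hab⟩ ⟨hb, rfl⟩
      · exact (hc v i).exists
end

section
/- Let G be a simple graph with a dumbbell coloring c. Then every triangle of G is monochromatic: if u, v, w are pairwise adjacent vertices of G, then c(u) = c(v) = c(w). -/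
open SimpleGraph

/-- A *dumbbell coloring* of a simple graph `G` is a two-coloring of the vertices
(by `Bool`) such that every vertex has exactly two neighbors of its own color and
exactly one neighbor of the opposite color. -/
def IsDumbbellColoring {V : Type*} [Fintype V] (G : SimpleGraph V) [DecidableRel G.Adj]
    (c : V → Bool) : Prop :=
  ∀ v : V, ((G.neighborFinset v).filter fun u => c u = c v).card = 2 ∧
    ((G.neighborFinset v).filter fun u => c u ≠ c v).card = 1

/-- In a dumbbell coloring, two neighbors of a vertex that both have the opposite color coincide. -/
theorem IsDumbbellColoring.eq_of_adj_of_ne {V : Type*} [Fintype V] {G : SimpleGraph V}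
    [DecidableRel G.Adj] {c : V → Bool} (hc : IsDumbbellColoring G c) {v a b : V}
    (ha : G.Adj v a) (hb : G.Adj v b) (hca : c a ≠ c v) (hcb : c b ≠ c v) : a = b :=
  Finset.card_le_one.mp (hc v).2.le a (by simp [ha, hca]) b (by simp [hb, hcb])

/-- In a graph with a dumbbell coloring, every triangle is monochromatic. -/
theorem triangle_monochromatic_of_dumbbell {V : Type*} [Fintype V]
    (G : SimpleGraph V) [DecidableRel G.Adj] (c : V → Bool)
    (hc : IsDumbbellColoring G c) :
    ∀ u v w : V, G.Adj u v → G.Adj v w → G.Adj u w → c u = c v ∧ c v = c w := by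
  intro u v w huv hvw huw
  have hu := fun h₁ h₂ => hvw.ne (hc.eq_of_adj_of_ne huv huw h₁ h₂)
  have hv := fun h₁ h₂ => huw.ne (hc.eq_of_adj_of_ne huv.symm hvw h₁ h₂)
  have hw := fun h₁ h₂ => huv.ne (hc.eq_of_adj_of_ne huw.symm hvw.symm h₁ h₂)
  revert hu hv hw
  cases c u <;> cases c v <;> cases c w <;> simp
end

section
/- Let G be a simple graph with a dumbbell coloring c. If a, b, w are pairwise adjacent vertices of G (a triangle) and v is a vertex adjacent to a with v ≠ b and v ≠ w, then c(v) ≠ c(a); i.e., any further neighbor of a vertex of a triangle receives the color opposite to that of the triangle. -/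
open SimpleGraph

namespace IsDumbbellColoring

variable {V : Type*} [Fintype V] {G : SimpleGraph V} [DecidableRel G.Adj] {c : V → Bool}

/-- Two neighbors of a vertex, both colored oppositely to it, are equal. -/
theorem eq_of_color_ne (hc : IsDumbbellColoring G c) {x y z : V}
    (hy : G.Adj x y) (hz : G.Adj x z) (hcy : c y ≠ c x) (hcz : c z ≠ c x) : y = z :=
  Finset.card_le_one.mp (hc x).2.le y (by simp [hy, hcy]) z (by simp [hz, hcz])

/-- Adjacent neighbors `y`, `z` of a vertex `x` have the same color as `x`. -/
theorem color_eq_of_triangle (hc : IsDumbbellColoring G c) {x y z : V}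
    (hxy : G.Adj x y) (hyz : G.Adj y z) (hxz : G.Adj x z) : c y = c x ∧ c z = c x := by
  have hx := fun h h' => hyz.ne (hc.eq_of_color_ne hxy hxz h h')
  have hy := fun h h' => hxz.ne (hc.eq_of_color_ne hxy.symm hyz h h')
  have hz := fun h h' => hxy.ne (hc.eq_of_color_ne hxz.symm hyz.symm h h')
  revert hx hy hz
  cases c x <;> cases c y <;> cases c z <;> simp

end IsDumbbellColoring

/-- In a graph with a dumbbell coloring, any further neighbor of a vertex of a triangle
receives the color opposite to that of the triangle. -/
theorem triangle_neighbor_opposite_of_dumbbell {V : Type*} [Fintype V]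
    (G : SimpleGraph V) [DecidableRel G.Adj] (c : V → Bool)
    (hc : IsDumbbellColoring G c) (a b w v : V)
    (hab : G.Adj a b) (hbw : G.Adj b w) (haw : G.Adj a w)
    (hav : G.Adj a v) (hvb : v ≠ b) (hvw : v ≠ w) :
    c v ≠ c a := by
  intro hcv
  obtain ⟨hcb, hcw⟩ := hc.color_eq_of_triangle hab hbw haw
  have h : 2 < ((G.neighborFinset a).filter fun u => c u = c a).card :=
    Finset.two_lt_card.mpr ⟨v, by simp [hav, hcv], b, by simp [hab, hcb], w,
      by simp [haw, hcw], hvb, hvw, hbw.ne⟩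
  exact h.ne' (hc a).1
end
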